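/- Let V be a real vector space with nondegenerate symmetric bilinear form g of dimension n ≥ 3, T a symmetric bilinear form with trace R, and A a nonzero lightlike covector (g^{-1}(A,A) = 0). Suppose the identity −(A^j B_j) g_{kl} + R A_k A_l + A_l B_k + (n−1) A_k B_l = 0 holds for a covector B. Then A^j B_j = 0 and B = −λ A for some scalar λ, and moreover R = nλ. -/

import Mathlib

/-- Pointwise algebraic step in case (II) (lightlike `A`): from the identity
(30), `−(A^j B_j) g_{kl} + R A_k A_l + A_l B_k + (n−1) A_k B_l = 0`, one gets
`A^j B_j = 0`, `B = −λ A` with `λ = K^l B_l`, and `R = nλ`. -/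
theorem lightlike_case_B_proportional
    (n : ℕ) (hn : 3 ≤ n)
    (g ginv T : Fin n → Fin n → ℝ)
    (A B K : Fin n → ℝ) (R : ℝ)
    (hgsymm : ∀ i j, g i j = g j i)
    (hTsymm : ∀ i j, T i j = T j i)
    (hinv : ∀ i j, ∑ k : Fin n, ginv i k * g k j = if i = j then (1:ℝ) else 0)
    (hR : R = ∑ j : Fin n, ∑ l : Fin n, ginv j l * T j l)
    -- `A` is lightlike and nonzero:
    (hAnull : ∑ i : Fin n, (∑ k : Fin n, ginv i k * A k) * A i = 0)
    (hAne : A ≠ 0)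
    -- `K` is a lightlike vector with `A(K) = −1`:
    (hKnull : ∑ k : Fin n, ∑ l : Fin n, g k l * K k * K l = 0)
    (hAK : ∑ i : Fin n, A i * K i = -1)
    -- the identity (30):
    (hmain : ∀ k l,
      -(∑ j : Fin n, (∑ m : Fin n, ginv j m * A m) * B j) * g k l
        + R * A k * A l + A l * B k + ((n : ℝ) - 1) * A k * B l = 0) :
    (∑ j : Fin n, (∑ m : Fin n, ginv j m * A m) * B j) = 0
      ∧ (∀ i, B i = -(∑ l : Fin n, K l * B l) * A i)
      ∧ R = (n : ℝ) * (∑ l : Fin n, K l * B l) := by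
  have hn2 : (n : ℝ) - 2 ≠ 0 := by
    have : (3 : ℝ) ≤ n := by exact_mod_cast hn
    linarith
  have hskew : ∀ k l, A k * B l = A l * B k := by
    intro k l
    have h1 := hmain k l
    have h2 := hmain l k
    rw [hgsymm l k] at h2
    have h3 : ((n : ℝ) - 2) * (A k * B l - A l * B k) = 0 := by
      linear_combination h1 - h2
    exact sub_eq_zero.mp ((mul_eq_zero.mp h3).resolve_left hn2)
  have hB : ∀ i, B i = -(∑ l : Fin n, K l * B l) * A i := by
    intro i
    have h : (∑ l : Fin n, K l * B l) * A i = (∑ l : Fin n, A l * K l) * B i := by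
      rw [Finset.sum_mul, Finset.sum_mul]
      refine Finset.sum_congr rfl fun l _ => ?_
      linear_combination K l * hskew i l
    rw [hAK] at h
    linear_combination h
  have h0 : (∑ j : Fin n, (∑ m : Fin n, ginv j m * A m) * B j) = 0 := by
    have h : (∑ j : Fin n, (∑ m : Fin n, ginv j m * A m) * B j)
        = -(∑ l : Fin n, K l * B l)
          * ∑ i : Fin n, (∑ k : Fin n, ginv i k * A k) * A i := by
      rw [Finset.mul_sum]
      refine Finset.sum_congr rfl fun j _ => ?_
      linear_combination (∑ m : Fin n, ginv j m * A m) * hB j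
    rw [h, hAnull, mul_zero]
  refine ⟨h0, hB, ?_⟩
  obtain ⟨i, hi⟩ := Function.ne_iff.mp hAne
  have hi' : A i ≠ 0 := hi
  have h1 := hmain i i
  rw [h0] at h1
  have h2 : (R - (n : ℝ) * (∑ l : Fin n, K l * B l)) * (A i * A i) = 0 := by
    linear_combination h1 - (n : ℝ) * A i * hB i
  exact sub_eq_zero.mp ((mul_eq_zero.mp h2).resolve_right (mul_ne_zero hi' hi'))
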